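/- Let N ≥ 2, let q > N, and let s, t be real numbers with -∞ < s ≤ t < N, and set α_{N,t} := (N-t)·ω_{N-1}^{1/(N-1)}. Then α_{N,t} is the sharp constant: the supremum, over all u ∈ L^q(ℝ^N;|x|^{-s}dx) ∩ Ẇ^{1,N}(ℝ^N) with u not almost everywhere zero and ∫_{ℝ^N}|∇u|^N dx ≤ 1, of the ratio ∫_{ℝ^N} e^{α_{N,t}|u|^{N/(N-1)}} |u|^q |x|^{-t} dx / (∫_{ℝ^N} |u|^q |x|^{-s} dx)^{(N-t)/(N-s)} is equal to +∞. -/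

import Mathlib

open MeasureTheory Real

/-- Surface area of the unit sphere `S^{N-1}` in `ℝ^N`, i.e. `ω_{N-1} = N · vol(B(0,1))`. -/
noncomputable def sphereArea (N : ℕ) : ℝ :=
  N * (volume (Metric.ball (0 : EuclideanSpace ℝ (Fin N)) 1)).toReal

/-- `Φ_N(τ) = Σ_{j ≥ N-1} τ^j / j!`, the exponential series with the first `N-1` terms removed. -/
noncomputable def PhiN (N : ℕ) (τ : ℝ) : ℝ :=
  ∑' j : ℕ, τ ^ (j + (N - 1)) / (Nat.factorial (j + (N - 1)) : ℝ)

/-- `g` is the weak gradient of `u` on `ℝ^N`: both are locally integrable and the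
integration-by-parts identity holds against all smooth compactly supported test functions. -/
def HasWeakGradient {N : ℕ} (u : EuclideanSpace ℝ (Fin N) → ℝ)
    (g : EuclideanSpace ℝ (Fin N) → EuclideanSpace ℝ (Fin N)) : Prop :=
  LocallyIntegrable u volume ∧ LocallyIntegrable g volume ∧
  ∀ φ : EuclideanSpace ℝ (Fin N) → ℝ, ContDiff ℝ (⊤ : ℕ∞) φ → HasCompactSupport φ →
    ∀ i : Fin N,
      ∫ x, u x * fderiv ℝ φ x (EuclideanSpace.single i 1) = - ∫ x, g x i * φ x

/-- The truncated logarithm `r ↦ -log r` on `[a, 1]`, constant on either side. -/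
noncomputable def moserProfile (a r : ℝ) : ℝ := -log (max a (min 1 r))

/-- The Moser function `c * moserProfile a ‖x‖`. -/
noncomputable def moserFun {N : ℕ} (a c : ℝ) (x : EuclideanSpace ℝ (Fin N)) : ℝ :=
  c * moserProfile a ‖x‖

open Classical in
/-- The weak gradient of `moserFun a c`. -/
noncomputable def moserGrad {N : ℕ} (a c : ℝ) (x : EuclideanSpace ℝ (Fin N)) :
    EuclideanSpace ℝ (Fin N) :=
  if a < ‖x‖ ∧ ‖x‖ < 1 then (-(c / ‖x‖ ^ 2)) • x else 0

lemma moserProfile_of_le {a r : ℝ} (ha : a ≤ 1) (hr : r ≤ a) : moserProfile a r = -log a := by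
  rw [moserProfile, min_eq_right (hr.trans ha), max_eq_left hr]

lemma moserProfile_of_one_le {a r : ℝ} (ha : a ≤ 1) (hr : 1 ≤ r) : moserProfile a r = 0 := by
  rw [moserProfile, min_eq_left hr, max_eq_right ha, log_one, neg_zero]

lemma moserProfile_of_mem {a r : ℝ} (h1 : a ≤ r) (h2 : r ≤ 1) : moserProfile a r = -log r := by
  rw [moserProfile, min_eq_right h2, max_eq_right h1]

lemma moserProfile_nonneg {a r : ℝ} (ha0 : 0 < a) (ha : a ≤ 1) : 0 ≤ moserProfile a r := by
  rw [moserProfile, neg_nonneg]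
  exact log_nonpos (ha0.le.trans (le_max_left _ _)) (max_le ha (min_le_left _ _))

lemma moserProfile_le {a r : ℝ} (hr0 : 0 < r) (hr : r ≤ 1) :
    moserProfile a r ≤ -log r := by
  rw [moserProfile, neg_le_neg_iff]
  exact log_le_log hr0 (by rw [min_eq_right hr]; exact le_max_right _ _)

lemma log_sub_log_le_of_le {a x y : ℝ} (ha : 0 < a) (hx : a ≤ x) (hy : a ≤ y) :
    log y - log x ≤ a⁻¹ * |y - x| := by
  have hx0 := ha.trans_le hx
  have hy0 := ha.trans_le hy
  calc log y - log x = log (y / x) := (log_div hy0.ne' hx0.ne').symm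
    _ ≤ y / x - 1 := log_le_sub_one_of_pos (div_pos hy0 hx0)
    _ = x⁻¹ * (y - x) := by field_simp
    _ ≤ x⁻¹ * |y - x| := by gcongr; exact le_abs_self _
    _ ≤ a⁻¹ * |y - x| := by gcongr

lemma lipschitzWith_moserProfile {a : ℝ} (ha : 0 < a) :
    LipschitzWith (Real.toNNReal a⁻¹) (moserProfile a) := by
  refine LipschitzWith.of_le_add_mul _ fun x y => ?_
  have h1 : LipschitzWith 1 fun r : ℝ => max a (min 1 r) :=
    (LipschitzWith.id.const_min 1).const_max a
  have h2 := h1.dist_le_mul y x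
  rw [Real.dist_eq, NNReal.coe_one, one_mul] at h2
  have h3 := log_sub_log_le_of_le ha (le_max_left a (min 1 x)) (le_max_left a (min 1 y))
  rw [Real.coe_toNNReal _ (inv_nonneg.2 ha.le), moserProfile, moserProfile, dist_comm]
  have h4 := mul_le_mul_of_nonneg_left h2 (inv_nonneg.2 ha.le)
  linarith

lemma lipschitzWith_moserFun {N : ℕ} {a c : ℝ} (ha : 0 < a) :
    ∃ C, LipschitzWith C (moserFun (N := N) a c) := by
  refine ⟨_, (lipschitzWith_smul c).comp ((lipschitzWith_moserProfile ha).comp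
    lipschitzWith_one_norm)⟩

lemma hasFDerivAt_moserFun {N : ℕ} {a c : ℝ} (ha0 : 0 < a) (ha : a ≤ 1)
    {x : EuclideanSpace ℝ (Fin N)} (h1 : ‖x‖ ≠ a) (h2 : ‖x‖ ≠ 1) :
    HasFDerivAt (moserFun a c) (innerSL ℝ (moserGrad a c x)) x := by
  have hc : Filter.Tendsto (fun y : EuclideanSpace ℝ (Fin N) => ‖y‖) (nhds x) (nhds ‖x‖) :=
    continuous_norm.tendsto x
  rcases lt_or_gt_of_ne h1 with h1 | h1
  · rw [moserGrad, if_neg fun h => h1.not_gt h.1, map_zero]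
    refine (hasFDerivAt_const (c * -log a) x).congr_of_eventuallyEq ?_
    filter_upwards [hc.eventually_lt_const h1] with y hy
    rw [moserFun, moserProfile_of_le ha hy.le]
  rcases lt_or_gt_of_ne h2 with h2 | h2
  · have hx : ‖x‖ ≠ 0 := (ha0.trans h1).ne'
    have h := ((hasStrictFDerivAt_norm_sq x).hasFDerivAt.log (by positivity)).const_mul (-c / 2)
    rw [moserGrad, if_pos ⟨h1, h2⟩]
    refine (h.congr_of_eventuallyEq ?_).congr_fderiv ?_
    · filter_upwards [hc.eventually_const_lt h1, hc.eventually_lt_const h2] with y hy1 hy2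
      rw [moserFun, moserProfile_of_mem hy1.le hy2.le, log_pow]
      push_cast
      ring
    · ext v
      simp
      field_simp
  · rw [moserGrad, if_neg fun h => h2.not_gt h.2, map_zero]
    refine (hasFDerivAt_const (0 : ℝ) x).congr_of_eventuallyEq ?_
    filter_upwards [hc.eventually_const_lt h2] with y hy
    rw [moserFun, moserProfile_of_one_le ha hy.le, mul_zero]

lemma norm_moserGrad {N : ℕ} {a c : ℝ} (ha0 : 0 < a) (hc : 0 ≤ c)
    (x : EuclideanSpace ℝ (Fin N)) :
    ‖moserGrad a c x‖ = (Set.Ioo a 1).indicator (fun r => c / r) ‖x‖ := by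
  by_cases h : a < ‖x‖ ∧ ‖x‖ < 1
  · have hx : 0 < ‖x‖ := ha0.trans h.1
    rw [moserGrad, if_pos h, Set.indicator_of_mem (by exact h), norm_smul, norm_neg, norm_div,
      norm_pow, norm_norm, Real.norm_of_nonneg hc]
    field_simp
  · rw [moserGrad, if_neg h, Set.indicator_of_notMem (by exact h), norm_zero]

lemma measurable_moserGrad {N : ℕ} (a c : ℝ) : Measurable (moserGrad (N := N) a c) := by
  unfold moserGrad
  refine Measurable.ite ?_ (by fun_prop) measurable_const
  exact (measurableSet_lt measurable_const measurable_norm).inter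
    (measurableSet_lt measurable_norm measurable_const)

lemma hasWeakGradient_moserFun {N : ℕ} (hN : 2 ≤ N) {a c : ℝ} (ha0 : 0 < a) (ha : a ≤ 1)
    (hc : 0 ≤ c) : HasWeakGradient (N := N) (moserFun a c) (moserGrad a c) := by
  obtain ⟨C, hC⟩ := lipschitzWith_moserFun (N := N) (c := c) ha0
  have : Nonempty (Fin N) := ⟨⟨0, by omega⟩⟩
  have : Nontrivial (EuclideanSpace ℝ (Fin N)) := inferInstance
  refine ⟨hC.continuous.locallyIntegrable, ?_, fun φ hφ hφc i => ?_⟩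
  · refine (locallyIntegrable_const (c / a)).mono (measurable_moserGrad a c).aestronglyMeasurable
      (Filter.Eventually.of_forall fun x => ?_)
    rw [norm_moserGrad ha0 hc, Real.norm_of_nonneg (by positivity)]
    refine Set.indicator_apply_le' (fun h => ?_) fun _ => by positivity
    have := h.1
    gcongr
  · obtain ⟨D, hD⟩ :=
      (hφ.of_le (m := 1) (by simp)).lipschitzWith_of_hasCompactSupport hφc one_ne_zero
    have key :=
      LipschitzWith.integral_lineDeriv_mul_eq (μ := volume) hC hD hφc (EuclideanSpace.single i 1)
    have h1 : ∫ x, lineDeriv ℝ (moserFun a c) x (EuclideanSpace.single i 1) * φ x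
        = ∫ x, moserGrad a c x i * φ x := by
      refine integral_congr_ae ?_
      have e1 : ∀ r : ℝ, ∀ᵐ x : EuclideanSpace ℝ (Fin N), ‖x‖ ≠ r := fun r => by
        have := Measure.addHaar_sphere (volume : Measure (EuclideanSpace ℝ (Fin N))) 0 r
        filter_upwards [measure_eq_zero_iff_ae_notMem.1 this] with x hx
        simpa using hx
      filter_upwards [e1 a, e1 1] with x hx1 hx2
      rw [((hasFDerivAt_moserFun ha0 ha hx1 hx2).hasLineDerivAt _).lineDeriv]
      simp [EuclideanSpace.inner_single_right]
    rw [← h1, key, ← integral_neg]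
    refine integral_congr_ae (Filter.Eventually.of_forall fun x => ?_)
    have : DifferentiableAt ℝ φ x := (hφ.differentiable (by simp)) x
    simp only [this.lineDeriv_eq_fderiv, map_neg]
    ring

lemma sphereArea_pos {N : ℕ} (hN : N ≠ 0) : 0 < sphereArea N := by
  have : 0 < (volume (Metric.ball (0 : EuclideanSpace ℝ (Fin N)) 1)).toReal :=
    ENNReal.toReal_pos (Metric.measure_ball_pos _ _ one_pos).ne' measure_ball_lt_top.ne
  unfold sphereArea
  positivity

lemma lintegral_fun_norm {N : ℕ} (hN : N ≠ 0) {f : ℝ → ℝ} (hf : ∀ r, 0 ≤ f r)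
    (hint : IntegrableOn (fun r => r ^ (N - 1) * f r) (Set.Ioi 0)) :
    ∫⁻ x : EuclideanSpace ℝ (Fin N), ENNReal.ofReal (f ‖x‖) =
      ENNReal.ofReal (sphereArea N * ∫ r in Set.Ioi (0 : ℝ), r ^ (N - 1) * f r) := by
  have : Nonempty (Fin N) := ⟨⟨0, by omega⟩⟩
  have : Nontrivial (EuclideanSpace ℝ (Fin N)) := inferInstance
  have hi : Integrable (fun x : EuclideanSpace ℝ (Fin N) => f ‖x‖) := by
    rw [integrable_fun_norm_addHaar (volume : Measure (EuclideanSpace ℝ (Fin N)))]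
    simpa using hint
  rw [← ofReal_integral_eq_lintegral_ofReal hi (Filter.Eventually.of_forall fun x => hf _),
    integral_fun_norm_addHaar]
  simp [sphereArea, measureReal_def, mul_assoc]

lemma lintegral_ball_rpow_norm {N : ℕ} (hN : N ≠ 0) {p R : ℝ} (hp : 0 < N + p) (hR : 0 < R) :
    ∫⁻ x in Metric.ball (0 : EuclideanSpace ℝ (Fin N)) R, ENNReal.ofReal (‖x‖ ^ p) =
      ENNReal.ofReal (sphereArea N * (R ^ (N + p) / (N + p))) := by
  have hpow : ∀ r ∈ Set.Ioi (0 : ℝ), r ^ (N - 1) * (Set.Iio R).indicator (fun r => |r| ^ p) r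
      = (Set.Iio R).indicator (fun r => r ^ (N + p - 1)) r := by
    intro r hr
    by_cases h : r ∈ Set.Iio R
    · rw [Set.indicator_of_mem h, Set.indicator_of_mem h, abs_of_pos hr, ← rpow_natCast,
        ← rpow_add hr, Nat.cast_sub (by omega)]
      congr 1
      push_cast
      ring
    · rw [Set.indicator_of_notMem h, Set.indicator_of_notMem h, mul_zero]
  have hset : Set.Iio R ∩ Set.Ioi 0 = Set.Ioo 0 R := by
    rw [Set.inter_comm, Set.Ioi_inter_Iio]
  have hint : IntegrableOn (fun r => r ^ (N - 1) * (Set.Iio R).indicator (fun r => |r| ^ p) r)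
      (Set.Ioi 0) := by
    rw [integrableOn_congr_fun hpow measurableSet_Ioi, IntegrableOn,
      integrable_indicator_iff measurableSet_Iio, IntegrableOn,
      Measure.restrict_restrict measurableSet_Iio, hset]
    exact (intervalIntegral.integrableOn_Ioo_rpow_iff hR).2 (by linarith)
  have h := lintegral_fun_norm hN (f := (Set.Iio R).indicator fun r => |r| ^ p)
    (fun r => Set.indicator_nonneg (fun _ _ => by positivity) r) hint
  rw [setIntegral_congr_fun measurableSet_Ioi hpow, integral_indicator measurableSet_Iio,
    Measure.restrict_restrict measurableSet_Iio, hset, ← integral_Ioc_eq_integral_Ioo,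
    ← intervalIntegral.integral_of_le hR.le, integral_rpow (Or.inl (by linarith)),
    sub_add_cancel, zero_rpow hp.ne', sub_zero] at h
  rw [← h, ← lintegral_indicator Metric.isOpen_ball.measurableSet]
  refine lintegral_congr fun x => ?_
  by_cases hx : ‖x‖ < R
  · rw [Set.indicator_of_mem (by simpa using hx), Set.indicator_of_mem (by exact hx), abs_norm]
  · rw [Set.indicator_of_notMem (by simpa using hx), Set.indicator_of_notMem (by exact hx),
      ENNReal.ofReal_zero]

lemma lintegral_norm_moserGrad {N : ℕ} (hN : N ≠ 0) {a c : ℝ} (ha0 : 0 < a) (ha : a ≤ 1)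
    (hc : 0 ≤ c) :
    ∫⁻ x : EuclideanSpace ℝ (Fin N), ENNReal.ofReal (‖moserGrad a c x‖ ^ (N : ℝ)) =
      ENNReal.ofReal (sphereArea N * (c ^ N * -log a)) := by
  have hpow : ∀ r ∈ Set.Ioi (0 : ℝ),
      r ^ (N - 1) * ((Set.Ioo a 1).indicator (fun r => c / r) r) ^ N
      = (Set.Ioo a 1).indicator (fun r => c ^ N * r⁻¹) r := by
    intro r hr
    have hr : r ≠ 0 := ne_of_gt hr
    by_cases h : r ∈ Set.Ioo a 1
    · rw [Set.indicator_of_mem h, Set.indicator_of_mem h, div_pow]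
      obtain ⟨n, rfl⟩ := Nat.exists_eq_succ_of_ne_zero hN
      simp only [Nat.succ_eq_add_one, Nat.add_sub_cancel, pow_succ]
      field_simp
    · rw [Set.indicator_of_notMem h, Set.indicator_of_notMem h, zero_pow hN, mul_zero]
  have hset : Set.Ioo a 1 ∩ Set.Ioi 0 = Set.Ioo a 1 :=
    Set.inter_eq_left.2 fun r hr => ha0.trans hr.1
  have hint : IntegrableOn
      (fun r => r ^ (N - 1) * ((Set.Ioo a 1).indicator (fun r => c / r) r) ^ N)
      (Set.Ioi 0) := by
    rw [integrableOn_congr_fun hpow measurableSet_Ioi, IntegrableOn,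
      integrable_indicator_iff measurableSet_Ioo, IntegrableOn,
      Measure.restrict_restrict measurableSet_Ioo, hset]
    refine (ContinuousOn.integrableOn_Icc ?_).mono_set Set.Ioo_subset_Icc_self
    exact continuousOn_const.mul (continuousOn_id.inv₀ fun r hr => (ha0.trans_le hr.1).ne')
  have h := lintegral_fun_norm hN
    (f := fun r => ((Set.Ioo a 1).indicator (fun r => c / r) r) ^ N)
    (fun r => pow_nonneg (Set.indicator_nonneg
      (fun y hy => div_nonneg hc (ha0.trans hy.1).le) r) N) hint
  rw [setIntegral_congr_fun measurableSet_Ioi hpow, integral_indicator measurableSet_Ioo,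
    Measure.restrict_restrict measurableSet_Ioo, hset, ← integral_Ioc_eq_integral_Ioo,
    ← intervalIntegral.integral_of_le ha, intervalIntegral.integral_const_mul,
    integral_inv_of_pos ha0 one_pos, one_div, log_inv] at h
  rw [← h]
  refine lintegral_congr fun x => ?_
  rw [norm_moserGrad ha0 hc, rpow_natCast]

lemma lintegral_moserFun_le {N : ℕ} (hN : N ≠ 0) {q s a c c₀ : ℝ} (hq : 0 < q) (hs : s < N)
    (ha0 : 0 < a) (ha : a ≤ 1) (hc : 0 ≤ c) (hcc : c ≤ c₀) :
    ∫⁻ x : EuclideanSpace ℝ (Fin N), ENNReal.ofReal (|moserFun a c x| ^ q * ‖x‖ ^ (-s)) ≤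
      ENNReal.ofReal ((c₀ * (2 * q / (N - s))) ^ q) *
        ENNReal.ofReal (sphereArea N * (1 / (N + -((N + s) / 2)))) := by
  have hNs : 0 < N - s := sub_pos.2 hs
  have hc₀ := hc.trans hcc
  rw [← one_rpow ((N : ℝ) + -((N + s) / 2)), ← lintegral_ball_rpow_norm hN (by linarith) one_pos,
    ← lintegral_const_mul' _ _ ENNReal.ofReal_ne_top,
    ← lintegral_indicator Metric.isOpen_ball.measurableSet]
  have h0 : ∀ᵐ x : EuclideanSpace ℝ (Fin N), x ≠ 0 := by
    have : Nonempty (Fin N) := ⟨⟨0, by omega⟩⟩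
    have : Nontrivial (EuclideanSpace ℝ (Fin N)) := inferInstance
    exact Measure.ae_ne volume 0
  refine lintegral_mono_ae ?_
  filter_upwards [h0] with x hx
  have hx : 0 < ‖x‖ := norm_pos_iff.2 hx
  by_cases h1 : ‖x‖ < 1
  · rw [Set.indicator_of_mem (by simpa using h1), ← ENNReal.ofReal_mul (by positivity)]
    refine ENNReal.ofReal_le_ofReal ?_
    set ε := (N - s) / (2 * q) with hε
    have hε0 : 0 < ε := by positivity
    have hlog : -log ‖x‖ ≤ ‖x‖ ^ (-ε) / ε := by
      rw [← log_inv, rpow_neg hx.le, ← inv_rpow hx.le]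
      exact log_le_rpow_div (by positivity) hε0
    have hu : |moserFun a c x| ≤ (c₀ * (2 * q / (N - s))) * ‖x‖ ^ (-ε) := by
      have hp := moserProfile_nonneg (r := ‖x‖) ha0 ha
      rw [moserFun, abs_of_nonneg (mul_nonneg hc hp)]
      calc c * moserProfile a ‖x‖ ≤ c₀ * (‖x‖ ^ (-ε) / ε) :=
            mul_le_mul hcc ((moserProfile_le hx h1.le).trans hlog) hp hc₀
        _ = _ := by rw [hε]; field_simp
    calc |moserFun a c x| ^ q * ‖x‖ ^ (-s)
        ≤ ((c₀ * (2 * q / (N - s))) * ‖x‖ ^ (-ε)) ^ q * ‖x‖ ^ (-s) := by gcongr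
      _ = _ := by
        rw [mul_rpow (by positivity) (by positivity), ← rpow_mul hx.le, mul_assoc, ← rpow_add hx]
        congr 2
        rw [hε]
        field_simp
        ring
  · rw [moserFun, moserProfile_of_one_le ha (not_lt.1 h1), mul_zero, abs_zero, zero_rpow hq.ne',
      zero_mul, ENNReal.ofReal_zero]
    exact zero_le

lemma lintegral_exp_moserFun_ge {N : ℕ} (hN : 2 ≤ N) {q t L c : ℝ} (ht : t < N)
    (hL : 0 < L) (hc : c = (sphereArea N * L) ^ (-(1 / (N : ℝ)))) :
    ENNReal.ofReal ((c * L) ^ q * (sphereArea N / (N - t))) ≤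
      ∫⁻ x : EuclideanSpace ℝ (Fin N), ENNReal.ofReal
          (Real.exp ((((N : ℝ) - t) * sphereArea N ^ (1 / ((N : ℝ) - 1))) *
              |moserFun (exp (-L)) c x| ^ ((N : ℝ) / ((N : ℝ) - 1))) *
                |moserFun (exp (-L)) c x| ^ q * ‖x‖ ^ (-t)) := by
  have hω := sphereArea_pos (N := N) (by omega)
  have hN1 : 0 < (N : ℝ) - 1 := by
    have : (2 : ℝ) ≤ N := by exact_mod_cast hN
    linarith
  have hN0 : 0 < (N : ℝ) := by linarith
  have hc0 : 0 < c := by rw [hc]; positivity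
  have hexp : ((N : ℝ) - t) * sphereArea N ^ (1 / ((N : ℝ) - 1)) *
      (c * L) ^ ((N : ℝ) / ((N : ℝ) - 1)) = (N - t) * L := by
    have h1 : c ^ ((N : ℝ) / ((N : ℝ) - 1)) =
        (sphereArea N ^ (1 / ((N : ℝ) - 1)))⁻¹ * (L ^ (1 / ((N : ℝ) - 1)))⁻¹ := by
      rw [hc, ← rpow_mul (by positivity), ← mul_inv, ← mul_rpow hω.le hL.le,
        ← rpow_neg (by positivity)]
      congr 1
      field_simp
    have h2 : L ^ ((N : ℝ) / ((N : ℝ) - 1)) = L ^ (1 / ((N : ℝ) - 1)) * L := by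
      rw [← rpow_add_one hL.ne']
      congr 1
      field_simp
      ring
    rw [mul_rpow hc0.le hL.le, h1, h2]
    field_simp
  have hball := lintegral_ball_rpow_norm (N := N) (by omega) (p := -t) (by linarith)
    (exp_pos (-L))
  have hK : 0 ≤ exp ((N - t) * L) * (c * L) ^ q := by positivity
  have : ENNReal.ofReal ((c * L) ^ q * (sphereArea N / (N - t))) =
      ENNReal.ofReal (exp ((N - t) * L) * (c * L) ^ q) *
        ∫⁻ x in Metric.ball (0 : EuclideanSpace ℝ (Fin N)) (exp (-L)),
          ENNReal.ofReal (‖x‖ ^ (-t)) := by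
    rw [hball, ← ENNReal.ofReal_mul hK, ← exp_mul]
    congr 1
    have : -L * (N + -t) = -((N - t) * L) := by ring
    rw [this, exp_neg, ← sub_eq_add_neg]
    have := exp_pos ((N - t) * L)
    field_simp
  rw [this, ← lintegral_const_mul' _ _ ENNReal.ofReal_ne_top]
  refine le_trans (le_of_eq ?_) (setLIntegral_le_lintegral (Metric.ball 0 (exp (-L))) _)
  refine setLIntegral_congr_fun Metric.isOpen_ball.measurableSet fun x hx => ?_
  have hx : ‖x‖ ≤ exp (-L) := by simpa using (Metric.mem_ball.1 hx).le
  have hu : |moserFun (exp (-L)) c x| = c * L := by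
    rw [moserFun, moserProfile_of_le (by simpa using hL.le) hx, log_exp, neg_neg,
      abs_of_pos (by positivity)]
  simp only [hu, hexp]
  rw [← ENNReal.ofReal_mul hK]

/-- **Sharpness of `α_{N,t}` in the exponentially weighted inequality with power `q > N`
(Theorem 1.3).** At `α = α_{N,t} = (N-t)·ω_{N-1}^{1/(N-1)}` the supremum of the ratio
`∫ e^{α_{N,t}|u|^{N/(N-1)}}|u|^q|x|^{-t} dx / (∫ |u|^q |x|^{-s} dx)^{(N-t)/(N-s)}`
over admissible `u` (not a.e. zero, `∫|∇u|^N ≤ 1`) is `+∞`. -/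
theorem weighted_moser_trudinger_exp_pow_sharp (N : ℕ) (hN : 2 ≤ N) (q : ℝ)
    (hq : (N : ℝ) < q) (s t : ℝ) (hst : s ≤ t) (htN : t < (N : ℝ)) :
    (⨆ (u : EuclideanSpace ℝ (Fin N) → ℝ)
       (g : EuclideanSpace ℝ (Fin N) → EuclideanSpace ℝ (Fin N))
       (_ : HasWeakGradient u g ∧ ¬ (u =ᵐ[volume] fun _ => (0 : ℝ)) ∧
            (∫⁻ x, ENNReal.ofReal (|u x| ^ q * ‖x‖ ^ (-s))) ≠ ⊤ ∧
            (∫⁻ x, ENNReal.ofReal (‖g x‖ ^ (N : ℝ))) ≤ 1),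
      (∫⁻ x, ENNReal.ofReal
          (Real.exp ((((N : ℝ) - t) * sphereArea N ^ (1 / ((N : ℝ) - 1))) *
              |u x| ^ ((N : ℝ) / ((N : ℝ) - 1))) * |u x| ^ q * ‖x‖ ^ (-t))) /
        (∫⁻ x, ENNReal.ofReal (|u x| ^ q * ‖x‖ ^ (-s))) ^
          (((N : ℝ) - t) / ((N : ℝ) - s))) = ⊤ := by
  have hN0 : N ≠ 0 := by omega
  have hN1 : 1 < (N : ℝ) := by exact_mod_cast hN
  have hω := sphereArea_pos hN0
  have hsN : s < N := hst.trans_lt htN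
  have hq0 : 0 < q := by linarith
  have hθ : 0 ≤ ((N : ℝ) - t) / (N - s) := div_nonneg (by linarith) (by linarith)
  set D : ENNReal := ENNReal.ofReal ((sphereArea N ^ (-(1 / (N : ℝ))) * (2 * q / (N - s))) ^ q) *
        ENNReal.ofReal (sphereArea N * (1 / (N + -((N + s) / 2)))) with hD
  have hDtop : D ≠ ⊤ := ENNReal.mul_ne_top ENNReal.ofReal_ne_top ENNReal.ofReal_ne_top
  have hlim : Filter.Tendsto (fun L : ℝ =>
      ENNReal.ofReal (((sphereArea N * L) ^ (-(1 / (N : ℝ))) * L) ^ q * (sphereArea N / (N - t))) /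
        D ^ (((N : ℝ) - t) / (N - s))) Filter.atTop (nhds ⊤) := by
    have h1 : Filter.Tendsto (fun L : ℝ => (sphereArea N * L) ^ (-(1 / (N : ℝ))) * L)
        Filter.atTop Filter.atTop := by
      have he : 0 < 1 - 1 / (N : ℝ) := by
        rw [sub_pos, div_lt_one (by linarith)]
        exact hN1
      refine ((tendsto_rpow_atTop he).const_mul_atTop
        (rpow_pos_of_pos hω (-(1 / (N : ℝ))))).congr' ?_
      filter_upwards [Filter.eventually_gt_atTop 0] with L hL
      rw [mul_rpow hω.le hL.le, mul_assoc, ← rpow_add_one hL.ne']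
      congr 2
      ring
    have h2 := ENNReal.tendsto_ofReal_atTop.comp
      (((tendsto_rpow_atTop hq0).comp h1).atTop_mul_const (div_pos hω (sub_pos.2 htN)))
    have hne : (D ^ (((N : ℝ) - t) / (N - s)))⁻¹ ≠ 0 :=
      ENNReal.inv_ne_zero.2 (ENNReal.rpow_ne_top_of_nonneg hθ hDtop)
    have h3 := ENNReal.Tendsto.mul_const (b := (D ^ (((N : ℝ) - t) / (N - s)))⁻¹) h2
      (Or.inl ENNReal.top_ne_zero)
    rw [ENNReal.top_mul hne] at h3
    exact h3
  refine top_le_iff.1 (le_of_tendsto hlim ?_)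
  filter_upwards [Filter.eventually_ge_atTop 1] with L hL
  have hL0 : 0 < L := by linarith
  set c := (sphereArea N * L) ^ (-(1 / (N : ℝ))) with hc
  have hc0 : 0 < c := by positivity
  have ha0 := exp_pos (-L)
  have ha : exp (-L) ≤ 1 := by simpa using hL0.le
  have hcle : c ≤ sphereArea N ^ (-(1 / (N : ℝ))) := by
    refine rpow_le_rpow_of_nonpos hω (le_mul_of_one_le_right hω.le hL) ?_
    rw [neg_nonpos]
    positivity
  have hden := lintegral_moserFun_le hN0 hq0 hsN ha0 ha hc0.le hcle
  have hnum := lintegral_exp_moserFun_ge (q := q) hN htN hL0 hc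
  have hadm : HasWeakGradient (N := N) (moserFun (exp (-L)) c) (moserGrad (exp (-L)) c) ∧
      ¬ (moserFun (N := N) (exp (-L)) c =ᵐ[volume] fun _ => (0 : ℝ)) ∧
      (∫⁻ x : EuclideanSpace ℝ (Fin N),
        ENNReal.ofReal (|moserFun (exp (-L)) c x| ^ q * ‖x‖ ^ (-s))) ≠ ⊤ ∧
      (∫⁻ x : EuclideanSpace ℝ (Fin N),
        ENNReal.ofReal (‖moserGrad (exp (-L)) c x‖ ^ (N : ℝ))) ≤ 1 := by
    refine ⟨hasWeakGradient_moserFun hN ha0 ha hc0.le, fun h => ?_,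
      (hden.trans_lt hDtop.lt_top).ne, ?_⟩
    · obtain ⟨C, hC⟩ := lipschitzWith_moserFun (N := N) (c := c) ha0
      have h0 := congrFun (hC.continuous.ae_eq_iff_eq volume continuous_const |>.1 h) 0
      rw [moserFun, moserProfile_of_le ha (by simpa using ha0.le), log_exp, neg_neg] at h0
      exact (mul_pos hc0 hL0).ne' h0
    · rw [lintegral_norm_moserGrad hN0 ha0 ha hc0.le, log_exp, neg_neg, hc, ← rpow_mul_natCast
        (by positivity), neg_mul, one_div_mul_cancel (by positivity), rpow_neg_one]
      refine (congrArg ENNReal.ofReal ?_).trans_le ENNReal.ofReal_one.le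
      field_simp
  refine le_iSup_of_le (moserFun (exp (-L)) c) <| le_iSup_of_le (moserGrad (exp (-L)) c) <|
    le_iSup_of_le hadm ?_
  exact ENNReal.div_le_div hnum (ENNReal.rpow_le_rpow hden hθ)
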